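/- arXiv:math/0606145 — 2 statements merged into one kernel-verified Lean document; each statement's English description precedes it below -/
import Mathlib

section
/- There is an absolute constant C > 0 such that for every spherically symmetric, smooth, compactly supported function u : ℝ³ → ℝ and every x ∈ ℝ³ with x ≠ 0, one has |u(x)| ≤ C · |x|^{−1/2} · ‖∇u‖_{L²(ℝ³)} (the radial Sobolev inequality). -/
open MeasureTheory Real

noncomputable section

/-- Physical space `ℝ³`. -/
abbrev Sp : Type := EuclideanSpace ℝ (Fin 3)

/-- The partial derivative of `u : ℝ³ → ℝ` in the `i`-th coordinate direction. -/
noncomputable def pd (i : Fin 3) (u : Sp → ℝ) (x : Sp) : ℝ :=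
  fderiv ℝ u x (EuclideanSpace.single i 1)

/-- If `r ↦ r² g'(r)²` is integrable on `(0, ∞)` and `g` vanishes somewhere beyond `R`, then
`R g(R)² ≤ ∫₀^∞ r² g'(r)² dr`. -/
lemma mul_sq_le_integral_sq_mul_deriv_sq {g : ℝ → ℝ} (hg : ContDiff ℝ 1 g)
    (hinteg : IntegrableOn (fun r ↦ r ^ 2 * deriv g r ^ 2) (Set.Ioi 0)) {R M : ℝ} (hR : 0 < R)
    (hRM : R ≤ M) (hM : g M = 0) :
    R * g R ^ 2 ≤ ∫ r in Set.Ioi (0 : ℝ), r ^ 2 * deriv g r ^ 2 := by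
  have hcont : Continuous (fun r ↦ r ^ 2 * deriv g r ^ 2) := by
    have := hg.continuous_deriv le_rfl
    fun_prop
  set t := R * g R with ht
  have hderiv : ∀ r ∈ Set.Icc R M,
      HasDerivAt (fun r ↦ -(2 * t * g r) + t ^ 2 * r⁻¹)
        (-(2 * t * deriv g r) + t ^ 2 * (-(r ^ 2)⁻¹)) r := fun r hr ↦
    (((hg.differentiable one_ne_zero r).hasDerivAt.const_mul (2 * t)).neg).add
      ((hasDerivAt_inv (hR.trans_le hr.1).ne').const_mul (t ^ 2))
  have hFTC := intervalIntegral.sub_le_integral_of_hasDeriv_right_of_le hRM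
    (fun r hr ↦ (hderiv r hr).continuousAt.continuousWithinAt)
    (fun r hr ↦ (hderiv r (Set.Ioo_subset_Icc_self hr)).hasDerivWithinAt)
    (hcont.integrableOn_Icc (μ := volume)) (fun r hr ↦ by
      have hr0 : r ≠ 0 := (hR.trans hr.1).ne'
      have hsq : r ^ 2 * deriv g r ^ 2 - (-(2 * t * deriv g r) + t ^ 2 * (-(r ^ 2)⁻¹))
          = (r * deriv g r + t * r⁻¹) ^ 2 := by
        field_simp
        ring
      linarith [sq_nonneg (r * deriv g r + t * r⁻¹)])
  have hmono : ∫ r in R..M, r ^ 2 * deriv g r ^ 2 ≤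
      ∫ r in Set.Ioi (0 : ℝ), r ^ 2 * deriv g r ^ 2 := by
    rw [intervalIntegral.integral_of_le hRM]
    exact setIntegral_mono_set hinteg (Filter.Eventually.of_forall fun r ↦ by positivity)
      (LE.le.eventuallyLE fun r hr ↦ hR.trans hr.1)
  have hM0 : 0 ≤ t ^ 2 * M⁻¹ := by
    have := hR.trans_le hRM
    positivity
  have hRval : t ^ 2 * R⁻¹ = R * g R ^ 2 := by
    rw [ht]
    field_simp
  have htg : t * g R = R * g R ^ 2 := by rw [ht]; ring
  rw [hM] at hFTC
  linarith

/-- The square of a directional derivative in a unit direction is at most `|∇u|²`. -/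
lemma fderiv_apply_sq_le_sum_pd_sq (u : Sp → ℝ) (y : Sp) {w : Sp} (hw : ‖w‖ = 1) :
    fderiv ℝ u y w ^ 2 ≤ ∑ i, pd i u y ^ 2 := by
  have hexp : fderiv ℝ u y w = ∑ i, w i * pd i u y := by
    conv_lhs => rw [← (EuclideanSpace.basisFun (Fin 3) ℝ).sum_repr w]
    simp [map_sum, pd]
  have hsum : ∑ i, w i ^ 2 = 1 := by
    rw [← EuclideanSpace.real_norm_sq_eq, hw, one_pow]
  calc fderiv ℝ u y w ^ 2 = (∑ i, w i * pd i u y) ^ 2 := by rw [hexp]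
    _ ≤ (∑ i, w i ^ 2) * ∑ i, pd i u y ^ 2 := Finset.sum_mul_sq_le_sq_mul_sq _ _ _
    _ = ∑ i, pd i u y ^ 2 := by rw [hsum, one_mul]

/-- The derivative of `u` along a line through the origin, as a derivative in the direction. -/
lemma deriv_comp_smul {u : Sp → ℝ} (hu : Differentiable ℝ u) (w : Sp) (r : ℝ) :
    deriv (fun s : ℝ ↦ u (s • w)) r = fderiv ℝ u (r • w) w := by
  have h : HasDerivAt (fun s : ℝ ↦ s • w) w r := by
    simpa using (hasDerivAt_id r).smul_const w
  exact ((hu (r • w)).hasFDerivAt.comp_hasDerivAt r h).deriv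

/-- For radial `u`, the square of the radial derivative is at most `|∇u|²`. -/
lemma deriv_profile_sq_le_sum_pd_sq {u : Sp → ℝ} (hu : Differentiable ℝ u)
    (hrad : ∀ x y : Sp, ‖x‖ = ‖y‖ → u x = u y) {e : Sp} (he : ‖e‖ = 1) (y : Sp) :
    deriv (fun s : ℝ ↦ u (s • e)) ‖y‖ ^ 2 ≤ ∑ i, pd i u y ^ 2 := by
  obtain ⟨w, hw, hy⟩ : ∃ w : Sp, ‖w‖ = 1 ∧ ‖y‖ • w = y := by
    rcases eq_or_ne y 0 with rfl | hy
    · exact ⟨e, he, by simp⟩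
    · exact ⟨‖y‖⁻¹ • y, norm_smul_inv_norm hy, smul_inv_smul₀ (norm_ne_zero_iff.2 hy) y⟩
  have hprofile : (fun s : ℝ ↦ u (s • e)) = fun s : ℝ ↦ u (s • w) :=
    funext fun s ↦ hrad _ _ (by rw [norm_smul, norm_smul, he, hw])
  rw [hprofile, deriv_comp_smul hu, hy]
  exact fderiv_apply_sq_le_sum_pd_sq u y hw

lemma continuous_pd {u : Sp → ℝ} (hu : ContDiff ℝ 1 u) (i : Fin 3) : Continuous (pd i u) := by
  unfold pd
  exact (hu.continuous_fderiv one_ne_zero).clm_apply continuous_const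

lemma hasCompactSupport_pd {u : Sp → ℝ} (hc : HasCompactSupport u) (i : Fin 3) :
    HasCompactSupport (pd i u) := by
  unfold pd
  exact hc.fderiv_apply ℝ _

lemma integrable_sum_pd_sq {u : Sp → ℝ} (hu : ContDiff ℝ 1 u) (hc : HasCompactSupport u) :
    Integrable (fun y ↦ ∑ i, pd i u y ^ 2) := by
  refine integrable_finsetSum _ fun i _ ↦ ?_
  have hsupp : HasCompactSupport (fun y ↦ pd i u y ^ 2) :=
    (hasCompactSupport_pd hc i).comp_left (g := fun z : ℝ ↦ z ^ 2) (by simp)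
  exact ((continuous_pd hu i).pow 2).integrable_of_hasCompactSupport hsupp

/-- The squared form of the radial Sobolev inequality, with the constant `3 |B₁| = 4π`. -/
lemma mul_norm_mul_sq_le_integral_sum_pd_sq {u : Sp → ℝ} (hu : ContDiff ℝ 1 u)
    (hc : HasCompactSupport u) (hrad : ∀ x y : Sp, ‖x‖ = ‖y‖ → u x = u y) {x : Sp} (hx : x ≠ 0) :
    3 * volume.real (Metric.ball (0 : Sp) 1) * (‖x‖ * u x ^ 2) ≤ ∫ y, ∑ i, pd i u y ^ 2 := by
  have hR : 0 < ‖x‖ := norm_pos_iff.2 hx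
  set e : Sp := EuclideanSpace.single 0 1
  have he : ‖e‖ = 1 := by simp [e]
  set g : ℝ → ℝ := fun s ↦ u (s • e)
  have hg : ContDiff ℝ 1 g := hu.comp (contDiff_id.smul contDiff_const)
  have hgc : HasCompactSupport g := by
    refine hc.comp_isClosedEmbedding (g := fun s : ℝ ↦ s • e) ?_
    exact isClosedEmbedding_smul_left (norm_ne_zero_iff.1 (by simp [he]))
  have hinteg : Integrable (fun r ↦ r ^ 2 * deriv g r ^ 2) := by
    have hcont : Continuous (fun r ↦ r ^ 2 * deriv g r ^ 2) := by
      have := hg.continuous_deriv le_rfl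
      fun_prop
    exact hcont.integrable_of_hasCompactSupport
      ((hgc.deriv.comp_left (g := fun z : ℝ ↦ z ^ 2) (by simp)).mul_left)
  obtain ⟨M, hM, hgM⟩ : ∃ M, ‖x‖ ≤ M ∧ g M = 0 := by
    have hev : ∀ᶠ s in Filter.atTop, g s = 0 := by
      have := hasCompactSupport_iff_eventuallyEq.1 hgc
      rw [Filter.coclosedCompact_eq_cocompact] at this
      exact this.filter_mono atTop_le_cocompact
    exact ((Filter.eventually_ge_atTop ‖x‖).and hev).exists
  have hgx : g ‖x‖ = u x := hrad _ _ (by simp [norm_smul, he])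
  have hone := mul_sq_le_integral_sq_mul_deriv_sq hg hinteg.integrableOn hR hM hgM
  rw [hgx] at hone
  calc 3 * volume.real (Metric.ball (0 : Sp) 1) * (‖x‖ * u x ^ 2)
      ≤ 3 * volume.real (Metric.ball (0 : Sp) 1) *
          ∫ r in Set.Ioi (0 : ℝ), r ^ 2 * deriv g r ^ 2 := by gcongr
    _ = ∫ y : Sp, deriv g ‖y‖ ^ 2 := by
        rw [integral_fun_norm_addHaar volume fun r ↦ deriv g r ^ 2]
        simp [mul_assoc]
    _ ≤ ∫ y, ∑ i, pd i u y ^ 2 :=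
        integral_mono_of_nonneg (Filter.Eventually.of_forall fun y ↦ sq_nonneg _)
          (integrable_sum_pd_sq hu hc) (Filter.Eventually.of_forall fun y ↦
            deriv_profile_sq_le_sum_pd_sq (hu.differentiable one_ne_zero) hrad he y)

/-- **Radial Sobolev inequality.** There is an absolute constant `C > 0` such that for
every spherically symmetric smooth compactly supported `u : ℝ³ → ℝ` and every `x ≠ 0`,
`|u(x)| ≤ C |x|^{-1/2} ‖∇u‖_{L²(ℝ³)}`. -/
theorem radial_sobolev :
    ∃ C > (0:ℝ), ∀ u : Sp → ℝ,
      ContDiff ℝ (⊤ : ℕ∞) u → HasCompactSupport u →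
      (∀ x y : Sp, ‖x‖ = ‖y‖ → u x = u y) →
      ∀ x : Sp, x ≠ 0 →
        |u x| ≤ C * ‖x‖ ^ (-(1/2) : ℝ) * Real.sqrt (∫ y, ∑ i, (pd i u y) ^ 2) := by
  have hK : 0 < 3 * volume.real (Metric.ball (0 : Sp) 1) :=
    mul_pos three_pos (ENNReal.toReal_pos (Metric.measure_ball_pos volume _ one_pos).ne'
      measure_ball_lt_top.ne)
  refine ⟨(√(3 * volume.real (Metric.ball (0 : Sp) 1)))⁻¹, by positivity,
    fun u hu hc hrad x hx ↦ ?_⟩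
  have hR : 0 < ‖x‖ := norm_pos_iff.2 hx
  have hmain := Real.sqrt_le_sqrt
    (mul_norm_mul_sq_le_integral_sum_pd_sq (hu.of_le (by exact_mod_cast le_top)) hc hrad hx)
  rw [Real.sqrt_mul hK.le, Real.sqrt_mul hR.le, Real.sqrt_sq_eq_abs] at hmain
  rw [Real.rpow_neg hR.le, ← Real.sqrt_eq_rpow, ← mul_inv, inv_mul_eq_div,
    le_div_iff₀ (by positivity)]
  linarith
end
end

section
/- Let f(u) := u⁵ log(2+u²), and let u be a spherically symmetric classical solution of ∂ₜₜ u = Δu − f(u) on I × ℝ³ with conserved energy E. Then there is an absolute constant C > 0 such that ∫_I ∫_{ℝ³} |u(t,x)|⁸ · log(2 + |u(t,x)|²) dx dt ≤ C · E². -/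
open MeasureTheory Real

noncomputable section

/-- The spatial Laplacian `Δu = ∑ i, ∂ᵢ∂ᵢ u`. -/
noncomputable def lap (u : Sp → ℝ) (x : Sp) : ℝ := ∑ i, pd i (pd i u) x

/-- The nonlinearity `f(u) = u⁵ log(2 + u²)`. -/
noncomputable def nonlin (u : ℝ) : ℝ := u ^ 5 * Real.log (2 + u ^ 2)

/-- The nonlinear potential `F(u) = ∫₀ᵘ f(v) dv`. -/
noncomputable def Fpot (u : ℝ) : ℝ := ∫ v in (0:ℝ)..u, nonlin v

/-- A classical solution of `∂ₜₜ u = Δu - f(u)` on `I × ℝ³`: a smooth function which is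
compactly supported in space for each time `t ∈ I` and solves the equation pointwise on
`I × ℝ³`. -/
def IsClassicalSolution (I : Set ℝ) (u : ℝ → Sp → ℝ) : Prop :=
  ContDiff ℝ (⊤ : ℕ∞) (fun p : ℝ × Sp => u p.1 p.2) ∧
  (∀ t ∈ I, HasCompactSupport (u t)) ∧
  (∀ t ∈ I, ∀ x, deriv (deriv fun s => u s x) t = lap (u t) x - nonlin (u t x))

/-- Spherical symmetry: `u(t,x)` depends only on `t` and `|x|`. -/
def IsRadialSolution (I : Set ℝ) (u : ℝ → Sp → ℝ) : Prop :=
  ∀ t ∈ I, ∀ x y : Sp, ‖x‖ = ‖y‖ → u t x = u t y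

/-- The energy `E(u)(t) = ∫ ½|∂ₜu|² + ½|∇ₓu|² + F(u) dx`. -/
noncomputable def energy (u : ℝ → Sp → ℝ) (t : ℝ) : ℝ :=
  ∫ x, ((1/2) * (deriv (fun s => u s x) t) ^ 2
      + (1/2) * ∑ i, (pd i (u t) x) ^ 2 + Fpot (u t x))

open scoped ContDiff Topology
open Set Filter

/-! ### The nonlinearity -/

lemma continuous_nonlin : Continuous nonlin := by
  unfold nonlin
  refine (continuous_id.pow 5).mul (Continuous.log (by fun_prop) fun x => ?_)
  positivity

lemma nonlin_neg (u : ℝ) : nonlin (-u) = -nonlin u := by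
  simp only [nonlin, neg_sq]; ring

lemma log_two_add_sq_pos (u : ℝ) : 0 < Real.log (2 + u ^ 2) :=
  Real.log_pos (by nlinarith [sq_nonneg u])

lemma hasDerivAt_Fpot (u : ℝ) : HasDerivAt Fpot (nonlin u) u :=
  intervalIntegral.integral_hasDerivAt_right (continuous_nonlin.intervalIntegrable _ _)
    continuous_nonlin.aestronglyMeasurable.stronglyMeasurableAtFilter
    continuous_nonlin.continuousAt

lemma contDiff_Fpot : ContDiff ℝ 1 Fpot := by
  refine contDiff_one_iff_deriv.2 ⟨fun u => (hasDerivAt_Fpot u).differentiableAt, ?_⟩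
  rw [funext fun u => (hasDerivAt_Fpot u).deriv]
  exact continuous_nonlin

lemma Fpot_zero : Fpot 0 = 0 := by simp [Fpot]

lemma Fpot_neg (u : ℝ) : Fpot (-u) = Fpot u := by
  have h := intervalIntegral.integral_comp_neg (a := 0) (b := u) nonlin
  simp only [nonlin_neg, intervalIntegral.integral_neg, neg_zero] at h
  rw [intervalIntegral.integral_symm 0 (-u), neg_inj] at h
  exact h.symm

lemma Fpot_abs (u : ℝ) : Fpot |u| = Fpot u := by
  rcases abs_choice u with h | h <;> rw [h]
  exact Fpot_neg u

lemma Fpot_pos {u : ℝ} (hu : u ≠ 0) : 0 < Fpot u := by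
  rw [← Fpot_abs]
  refine intervalIntegral.intervalIntegral_pos_of_pos_on
    (continuous_nonlin.intervalIntegrable _ _) (fun x hx => ?_) (abs_pos.2 hu)
  exact mul_pos (pow_pos hx.1 5) (log_two_add_sq_pos x)

lemma Fpot_nonneg (u : ℝ) : 0 ≤ Fpot u := by
  rcases eq_or_ne u 0 with rfl | h
  · exact Fpot_zero.ge
  · exact (Fpot_pos h).le

lemma six_mul_Fpot_le (u : ℝ) : 6 * Fpot u ≤ u * nonlin u := by
  have key : ∀ w : ℝ, 0 ≤ w → 6 * Fpot w ≤ w * nonlin w := fun w hw => by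
    have h : Fpot w ≤ ∫ v in (0 : ℝ)..w, v ^ 5 * Real.log (2 + w ^ 2) := by
      refine intervalIntegral.integral_mono_on hw (continuous_nonlin.intervalIntegrable _ _)
        (Continuous.intervalIntegrable (by fun_prop) _ _) fun v hv => ?_
      refine mul_le_mul_of_nonneg_left (Real.log_le_log (by positivity) ?_) (pow_nonneg hv.1 5)
      nlinarith [hv.1, hv.2]
    rw [intervalIntegral.integral_mul_const, integral_pow] at h
    unfold nonlin
    norm_num at h
    linarith
  have h := key |u| (abs_nonneg u)
  rw [Fpot_abs] at h
  rcases abs_choice u with h' | h' <;> rw [h'] at h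
  · exact h
  · rwa [nonlin_neg, neg_mul_neg] at h

/-! ### Calculus on the `(t, r)` half-plane -/

/-- The partial derivative in the time variable. -/
def partialTime (g : ℝ × ℝ → ℝ) (p : ℝ × ℝ) : ℝ := fderiv ℝ g p (1, 0)

/-- The partial derivative in the radial variable. -/
def partialRadius (g : ℝ × ℝ → ℝ) (p : ℝ × ℝ) : ℝ := fderiv ℝ g p (0, 1)

local notation "∂ₜ" => partialTime
local notation "∂ᵣ" => partialRadius

lemma hasDerivAt_partialTime {g : ℝ × ℝ → ℝ} (hg : Differentiable ℝ g) (t r : ℝ) :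
    HasDerivAt (fun s => g (s, r)) (∂ₜ g (t, r)) t :=
  (hg (t, r)).hasFDerivAt.comp_hasDerivAt t ((hasDerivAt_id t).prodMk (hasDerivAt_const t r))

lemma hasDerivAt_partialRadius {g : ℝ × ℝ → ℝ} (hg : Differentiable ℝ g) (t r : ℝ) :
    HasDerivAt (fun s => g (t, s)) (∂ᵣ g (t, r)) r :=
  (hg (t, r)).hasFDerivAt.comp_hasDerivAt r ((hasDerivAt_const r t).prodMk (hasDerivAt_id r))

lemma contDiff_partialTime {g : ℝ × ℝ → ℝ} (hg : ContDiff ℝ ∞ g) :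
    ContDiff ℝ ∞ (∂ₜ g) :=
  (hg.fderiv_right (by simp)).clm_apply contDiff_const

lemma contDiff_partialRadius {g : ℝ × ℝ → ℝ} (hg : ContDiff ℝ ∞ g) :
    ContDiff ℝ ∞ (∂ᵣ g) :=
  (hg.fderiv_right (by simp)).clm_apply contDiff_const

lemma partialTime_partialRadius {g : ℝ × ℝ → ℝ} (hg : ContDiff ℝ 2 g) (p : ℝ × ℝ) :
    ∂ₜ (∂ᵣ g) p = ∂ᵣ (∂ₜ g) p := by
  have hd : DifferentiableAt ℝ (fderiv ℝ g) p :=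
    ((hg.fderiv_right (m := 1) (by norm_num)).differentiable (by norm_num)) p
  have key : ∀ w z : ℝ × ℝ,
      fderiv ℝ (fun q => fderiv ℝ g q w) p z = fderiv ℝ (fderiv ℝ g) p z w := fun w z => by
    rw [fderiv_clm_apply hd (differentiableAt_const w)]
    simp
  have hs : IsSymmSndFDerivAt ℝ g p :=
    hg.contDiffAt.isSymmSndFDerivAt (by simp)
  unfold partialTime partialRadius
  rw [key, key]
  exact hs _ _

lemma integral_divergence_rectangle {P Q : ℝ × ℝ → ℝ} (hP : ContDiff ℝ 1 P)
    (hQ : ContDiff ℝ 1 Q) (a b c d : ℝ) :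
    ∫ t in a..b, ∫ r in c..d, (∂ₜ P (t, r) + ∂ᵣ Q (t, r)) =
      (((∫ t in a..b, Q (t, d)) - ∫ t in a..b, Q (t, c)) + ∫ r in c..d, P (b, r)) -
        ∫ r in c..d, P (a, r) := by
  refine integral2_divergence_prod_of_hasFDerivAt_off_countable P Q (fderiv ℝ P) (fderiv ℝ Q)
    a c b d ∅ Set.countable_empty hP.continuous.continuousOn hQ.continuous.continuousOn
    (fun p _ => (hP.differentiable one_ne_zero p).hasFDerivAt)
    (fun p _ => (hQ.differentiable one_ne_zero p).hasFDerivAt) ?_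
  have hP' := (hP.continuous_fderiv one_ne_zero).clm_apply (continuous_const (y := ((1 : ℝ), (0 : ℝ))))
  have hQ' := (hQ.continuous_fderiv one_ne_zero).clm_apply (continuous_const (y := ((0 : ℝ), (1 : ℝ))))
  exact (hP'.add hQ').continuousOn.integrableOn_compact (isCompact_uIcc.prod isCompact_uIcc)

/-! ### The reduced radial wave equation -/

/-- `φ(t, r)` solves `φ_tt = φ_rr + (2 / r) φ_r - f(φ)` for `t ∈ J` and `r ≥ 0`. -/
structure IsRadialWave (J : Set ℝ) (φ : ℝ × ℝ → ℝ) : Prop where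
  contDiff : ContDiff ℝ ∞ φ
  equation : ∀ t ∈ J, ∀ r ≥ 0,
    r * ∂ₜ (∂ₜ φ) (t, r) = r * ∂ᵣ (∂ᵣ φ) (t, r) + 2 * ∂ᵣ φ (t, r) - r * nonlin (φ (t, r))

/-- The reduced wave `r φ(t, r)`. -/
def reduced (φ : ℝ × ℝ → ℝ) (p : ℝ × ℝ) : ℝ := p.2 * φ p

/-- The momentum density of the reduced wave. -/
def momentum (φ : ℝ × ℝ → ℝ) (p : ℝ × ℝ) : ℝ := ∂ₜ (reduced φ) p * ∂ᵣ (reduced φ) p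

/-- The potential energy density of the reduced wave. -/
def potentialDensity (φ : ℝ × ℝ → ℝ) (p : ℝ × ℝ) : ℝ := p.2 ^ 2 * Fpot (φ p)

/-- The energy density of the reduced wave. -/
def reducedEnergy (φ : ℝ × ℝ → ℝ) (p : ℝ × ℝ) : ℝ :=
  (1 / 2) * ∂ₜ (reduced φ) p ^ 2 + (1 / 2) * ∂ᵣ (reduced φ) p ^ 2 + potentialDensity φ p

lemma contDiff_reduced {φ : ℝ × ℝ → ℝ} (hφ : ContDiff ℝ ∞ φ) : ContDiff ℝ ∞ (reduced φ) :=
  contDiff_snd.mul hφ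

lemma contDiff_momentum {φ : ℝ × ℝ → ℝ} (hφ : ContDiff ℝ ∞ φ) : ContDiff ℝ 1 (momentum φ) :=
  ((contDiff_partialTime (contDiff_reduced hφ)).mul
    (contDiff_partialRadius (contDiff_reduced hφ))).of_le (by simp)

lemma contDiff_potentialDensity {φ : ℝ × ℝ → ℝ} (hφ : ContDiff ℝ ∞ φ) :
    ContDiff ℝ 1 (potentialDensity φ) :=
  (contDiff_snd.pow 2).mul (contDiff_Fpot.comp (hφ.of_le (by simp)))

lemma contDiff_reducedEnergy {φ : ℝ × ℝ → ℝ} (hφ : ContDiff ℝ ∞ φ) :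
    ContDiff ℝ 1 (reducedEnergy φ) := by
  have h₁ := (contDiff_partialTime (contDiff_reduced hφ)).of_le (m := 1) (by simp)
  have h₂ := (contDiff_partialRadius (contDiff_reduced hφ)).of_le (m := 1) (by simp)
  exact ((contDiff_const.mul (h₁.pow 2)).add (contDiff_const.mul (h₂.pow 2))).add
    (contDiff_potentialDensity hφ)

lemma partialTime_reduced {φ : ℝ × ℝ → ℝ} (hφ : Differentiable ℝ φ) (t r : ℝ) :
    ∂ₜ (reduced φ) (t, r) = r * ∂ₜ φ (t, r) :=
  (hasDerivAt_partialTime (differentiable_snd.mul hφ) t r).unique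
    ((hasDerivAt_partialTime hφ t r).const_mul r)

lemma partialRadius_reduced {φ : ℝ × ℝ → ℝ} (hφ : Differentiable ℝ φ) (t r : ℝ) :
    ∂ᵣ (reduced φ) (t, r) = φ (t, r) + r * ∂ᵣ φ (t, r) := by
  have h := (hasDerivAt_id r).mul (hasDerivAt_partialRadius hφ t r)
  rw [id, one_mul] at h
  exact (hasDerivAt_partialRadius (differentiable_snd.mul hφ) t r).unique h

lemma partialTime_partialTime_reduced {φ : ℝ × ℝ → ℝ} (hφ : ContDiff ℝ ∞ φ) (t r : ℝ) :
    ∂ₜ (∂ₜ (reduced φ)) (t, r) = r * ∂ₜ (∂ₜ φ) (t, r) := by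
  have h := hasDerivAt_partialTime
    ((contDiff_partialTime (contDiff_reduced hφ)).differentiable (by simp)) t r
  simp only [partialTime_reduced (hφ.differentiable (by simp))] at h
  exact h.unique
    ((hasDerivAt_partialTime ((contDiff_partialTime hφ).differentiable (by simp)) t r).const_mul r)

lemma partialRadius_partialRadius_reduced {φ : ℝ × ℝ → ℝ} (hφ : ContDiff ℝ ∞ φ) (t r : ℝ) :
    ∂ᵣ (∂ᵣ (reduced φ)) (t, r) = r * ∂ᵣ (∂ᵣ φ) (t, r) + 2 * ∂ᵣ φ (t, r) := by
  have hd := hφ.differentiable (by simp)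
  have h := hasDerivAt_partialRadius
    ((contDiff_partialRadius (contDiff_reduced hφ)).differentiable (by simp)) t r
  simp only [partialRadius_reduced hd] at h
  refine (h.unique ((hasDerivAt_partialRadius hd t r).add ((hasDerivAt_id r).mul
    (hasDerivAt_partialRadius ((contDiff_partialRadius hφ).differentiable (by simp)) t r)))).trans ?_
  simp only [id]
  ring

lemma IsRadialWave.reduced_equation {J : Set ℝ} {φ : ℝ × ℝ → ℝ} (hφ : IsRadialWave J φ)
    {t r : ℝ} (ht : t ∈ J) (hr : 0 ≤ r) :
    ∂ₜ (∂ₜ (reduced φ)) (t, r) = ∂ᵣ (∂ᵣ (reduced φ)) (t, r) - r * nonlin (φ (t, r)) := by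
  rw [partialTime_partialTime_reduced hφ.contDiff, partialRadius_partialRadius_reduced hφ.contDiff,
    hφ.equation t ht r hr]

lemma partialTime_reducedEnergy {φ : ℝ × ℝ → ℝ} (hφ : ContDiff ℝ ∞ φ) (t r : ℝ) :
    ∂ₜ (reducedEnergy φ) (t, r) =
      ∂ₜ (reduced φ) (t, r) * ∂ₜ (∂ₜ (reduced φ)) (t, r) +
        ∂ᵣ (reduced φ) (t, r) * ∂ₜ (∂ᵣ (reduced φ)) (t, r) +
          r ^ 2 * (nonlin (φ (t, r)) * ∂ₜ φ (t, r)) := by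
  have hv := contDiff_reduced hφ
  have h₁ := hasDerivAt_partialTime ((contDiff_partialTime hv).differentiable (by simp)) t r
  have h₂ := hasDerivAt_partialTime ((contDiff_partialRadius hv).differentiable (by simp)) t r
  have h₃ := (hasDerivAt_Fpot (φ (t, r))).comp t
    (hasDerivAt_partialTime (hφ.differentiable (by simp)) t r)
  refine ((hasDerivAt_partialTime ((contDiff_reducedEnergy hφ).differentiable one_ne_zero) t
    r).unique ((((h₁.pow 2).const_mul (1 / 2)).add ((h₂.pow 2).const_mul (1 / 2))).add
      (h₃.const_mul (r ^ 2)))).trans ?_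
  ring

lemma partialRadius_reducedEnergy {φ : ℝ × ℝ → ℝ} (hφ : ContDiff ℝ ∞ φ) (t r : ℝ) :
    ∂ᵣ (reducedEnergy φ) (t, r) =
      ∂ₜ (reduced φ) (t, r) * ∂ᵣ (∂ₜ (reduced φ)) (t, r) +
        ∂ᵣ (reduced φ) (t, r) * ∂ᵣ (∂ᵣ (reduced φ)) (t, r) +
          ∂ᵣ (potentialDensity φ) (t, r) := by
  have hv := contDiff_reduced hφ
  have h₁ := hasDerivAt_partialRadius ((contDiff_partialTime hv).differentiable (by simp)) t r
  have h₂ := hasDerivAt_partialRadius ((contDiff_partialRadius hv).differentiable (by simp)) t r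
  have h₃ := hasDerivAt_partialRadius
    ((contDiff_potentialDensity hφ).differentiable one_ne_zero) t r
  refine ((hasDerivAt_partialRadius ((contDiff_reducedEnergy hφ).differentiable one_ne_zero) t
    r).unique ((((h₁.pow 2).const_mul (1 / 2)).add ((h₂.pow 2).const_mul (1 / 2))).add
      h₃)).trans ?_
  ring

lemma partialRadius_potentialDensity {φ : ℝ × ℝ → ℝ} (hφ : ContDiff ℝ ∞ φ) (t r : ℝ) :
    ∂ᵣ (potentialDensity φ) (t, r) =
      2 * r * Fpot (φ (t, r)) + r ^ 2 * (nonlin (φ (t, r)) * ∂ᵣ φ (t, r)) := by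
  have h := (hasDerivAt_Fpot (φ (t, r))).comp r
    (hasDerivAt_partialRadius (hφ.differentiable (by simp)) t r)
  refine ((hasDerivAt_partialRadius ((contDiff_potentialDensity hφ).differentiable one_ne_zero) t
    r).unique (((hasDerivAt_id r).pow 2).mul h)).trans ?_
  simp

lemma partialTime_momentum {φ : ℝ × ℝ → ℝ} (hφ : ContDiff ℝ ∞ φ) (t r : ℝ) :
    ∂ₜ (momentum φ) (t, r) = ∂ₜ (∂ₜ (reduced φ)) (t, r) * ∂ᵣ (reduced φ) (t, r) +
      ∂ₜ (reduced φ) (t, r) * ∂ₜ (∂ᵣ (reduced φ)) (t, r) := by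
  have hv := contDiff_reduced hφ
  exact (hasDerivAt_partialTime ((contDiff_momentum hφ).differentiable one_ne_zero) t r).unique
    ((hasDerivAt_partialTime ((contDiff_partialTime hv).differentiable (by simp)) t r).mul
      (hasDerivAt_partialTime ((contDiff_partialRadius hv).differentiable (by simp)) t r))

lemma partialRadius_momentum {φ : ℝ × ℝ → ℝ} (hφ : ContDiff ℝ ∞ φ) (t r : ℝ) :
    ∂ᵣ (momentum φ) (t, r) = ∂ᵣ (∂ₜ (reduced φ)) (t, r) * ∂ᵣ (reduced φ) (t, r) +
      ∂ₜ (reduced φ) (t, r) * ∂ᵣ (∂ᵣ (reduced φ)) (t, r) := by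
  have hv := contDiff_reduced hφ
  exact (hasDerivAt_partialRadius ((contDiff_momentum hφ).differentiable one_ne_zero) t r).unique
    ((hasDerivAt_partialRadius ((contDiff_partialTime hv).differentiable (by simp)) t r).mul
      (hasDerivAt_partialRadius ((contDiff_partialRadius hv).differentiable (by simp)) t r))

/-- Local conservation of energy. -/
lemma IsRadialWave.energy_flux {J : Set ℝ} {φ : ℝ × ℝ → ℝ} (hφ : IsRadialWave J φ)
    {t r : ℝ} (ht : t ∈ J) (hr : 0 ≤ r) :
    ∂ₜ (reducedEnergy φ) (t, r) = ∂ᵣ (momentum φ) (t, r) := by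
  have hc := hφ.contDiff
  have hv : ContDiff ℝ 2 (reduced φ) := 
    contDiff_infty.1 (contDiff_reduced hc) 2
  rw [partialTime_reducedEnergy hc, partialRadius_momentum hc, hφ.reduced_equation ht hr,
    partialTime_partialRadius hv,
    partialTime_reduced (hc.differentiable (by simp))]
  ring

/-- The pointwise Morawetz identity. -/
lemma IsRadialWave.morawetz_flux {J : Set ℝ} {φ : ℝ × ℝ → ℝ} (hφ : IsRadialWave J φ)
    {t r : ℝ} (ht : t ∈ J) (hr : 0 ≤ r) :
    ∂ₜ (momentum φ) (t, r) +
        ∂ᵣ (fun p => 2 * potentialDensity φ p - reducedEnergy φ p) (t, r) =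
      -(r * (φ (t, r) * nonlin (φ (t, r)) - 2 * Fpot (φ (t, r)))) := by
  have hc := hφ.contDiff
  have hv : ContDiff ℝ 2 (reduced φ) := 
    contDiff_infty.1 (contDiff_reduced hc) 2
  have hF := (contDiff_potentialDensity hc).differentiable one_ne_zero
  have hE := (contDiff_reducedEnergy hc).differentiable one_ne_zero
  have hsub : ∂ᵣ (fun p => 2 * potentialDensity φ p - reducedEnergy φ p) (t, r) =
      2 * ∂ᵣ (potentialDensity φ) (t, r) - ∂ᵣ (reducedEnergy φ) (t, r) :=
    (hasDerivAt_partialRadius ((hF.const_mul 2).sub hE) t r).unique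
      (((hasDerivAt_partialRadius hF t r).const_mul 2).sub (hasDerivAt_partialRadius hE t r))
  rw [hsub, partialTime_momentum hc, partialRadius_reducedEnergy hc,
    partialRadius_potentialDensity hc, hφ.reduced_equation ht hr,
    partialTime_partialRadius hv,
    partialRadius_reduced (hc.differentiable (by simp))]
  ring

lemma potentialDensity_nonneg (φ : ℝ × ℝ → ℝ) (p : ℝ × ℝ) : 0 ≤ potentialDensity φ p :=
  mul_nonneg (sq_nonneg _) (Fpot_nonneg _)

lemma abs_momentum_le (φ : ℝ × ℝ → ℝ) (p : ℝ × ℝ) : |momentum φ p| ≤ reducedEnergy φ p := by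
  have := potentialDensity_nonneg φ p
  unfold momentum reducedEnergy
  rw [abs_le]
  constructor <;>
    nlinarith [sq_nonneg (∂ₜ (reduced φ) p + ∂ᵣ (reduced φ) p),
      sq_nonneg (∂ₜ (reduced φ) p - ∂ᵣ (reduced φ) p)]

lemma reducedEnergy_nonneg (φ : ℝ × ℝ → ℝ) (p : ℝ × ℝ) : 0 ≤ reducedEnergy φ p :=
  (abs_nonneg _).trans (abs_momentum_le φ p)

lemma densities_eq_zero {φ : ℝ × ℝ → ℝ} {p : ℝ × ℝ} (h : ∀ᶠ q in 𝓝 p, φ q = 0) :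
    potentialDensity φ p = 0 ∧ reducedEnergy φ p = 0 := by
  have hv : reduced φ =ᶠ[𝓝 p] fun _ => 0 := h.mono fun q hq => by simp [reduced, hq]
  have hpot : potentialDensity φ p = 0 := by simp [potentialDensity, h.self_of_nhds, Fpot_zero]
  refine ⟨hpot, ?_⟩
  simp [reducedEnergy, hpot, partialTime, partialRadius, hv.fderiv_eq]

lemma eventually_nhds_of_exterior {φ : ℝ × ℝ → ℝ} {t R r : ℝ} (hr : R < r)
    (h : ∀ᶠ s in 𝓝 t, ∀ ρ > R, φ (s, ρ) = 0) : ∀ᶠ q in 𝓝 (t, r), φ q = 0 := by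
  rw [nhds_prod_eq]
  filter_upwards [h.prod_mk (Ioi_mem_nhds hr)] with q hq using hq.1 q.2 hq.2

/-- Finite speed of propagation for data vanishing outside a ball. -/
lemma IsRadialWave.eq_zero_of_exterior {J : Set ℝ} {φ : ℝ × ℝ → ℝ} (hφ : IsRadialWave J φ)
    {t₀ t₁ R r : ℝ} (ht : t₀ ≤ t₁) (hJ : Icc t₀ t₁ ⊆ J) (hR : 0 ≤ R)
    (hdata : ∀ᶠ s in 𝓝 t₀, ∀ ρ > R, φ (s, ρ) = 0) (hr : R + (t₁ - t₀) < r) :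
    φ (t₁, r) = 0 := by
  by_contra hne
  set M := r + (t₁ - t₀) + 1 with hM
  set η := expNegInvGlue with hη
  have hη_smooth : ContDiff ℝ 1 η := expNegInvGlue.contDiff (n := 1)
  have hη_deriv : ∀ x, HasDerivAt η (deriv η x) x := fun x =>
    (hη_smooth.differentiable one_ne_zero x).hasDerivAt
  have hη_deriv_nonneg : ∀ x, 0 ≤ deriv η x := fun x => expNegInvGlue.monotone.deriv_nonneg
  set χ : ℝ × ℝ → ℝ := fun p => η (p.2 - R - (p.1 - t₀)) * η (M - (p.1 - t₀) - p.2) with hχ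
  have hχ_smooth : ContDiff ℝ 1 χ := by
    refine (hη_smooth.comp ?_).mul (hη_smooth.comp ?_) <;> fun_prop
  have hχ_nonneg : ∀ p, 0 ≤ χ p := fun p =>
    mul_nonneg (expNegInvGlue.nonneg _) (expNegInvGlue.nonneg _)
  have he := contDiff_reducedEnergy hφ.contDiff
  have hm := contDiff_momentum hφ.contDiff
  have hdiv := integral_divergence_rectangle (hχ_smooth.mul he) (hχ_smooth.mul hm).neg
    t₀ t₁ 0 M
  have hM0 : 0 ≤ M := by linarith
  have hflux : ∫ t in t₀..t₁, ∫ r in (0 : ℝ)..M, (∂ₜ (fun p => χ p * reducedEnergy φ p) (t, r) +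
      ∂ᵣ (fun p => -(χ p * momentum φ p)) (t, r)) ≤ 0 := by
    rw [← neg_nonneg, ← intervalIntegral.integral_neg]
    refine intervalIntegral.integral_nonneg ht fun t htt => ?_
    rw [← intervalIntegral.integral_neg]
    refine intervalIntegral.integral_nonneg hM0 fun ρ hρ => ?_
    have hd := hφ.energy_flux (hJ htt) hρ.1
    have hA := hη_deriv (ρ - R - (t - t₀))
    have hB := hη_deriv (M - (t - t₀) - ρ)
    have hAt : HasDerivAt (fun s => η (ρ - R - (s - t₀))) (-deriv η (ρ - R - (t - t₀))) t := by
      exact (hA.comp t (((hasDerivAt_id t).sub_const t₀).const_sub (ρ - R))).congr_deriv (mul_neg_one _)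
    have hBt : HasDerivAt (fun s => η (M - (s - t₀) - ρ)) (-deriv η (M - (t - t₀) - ρ)) t := by
      exact (hB.comp t ((((hasDerivAt_id t).sub_const t₀).const_sub M).sub_const ρ)).congr_deriv (mul_neg_one _)
    have hAr : HasDerivAt (fun s => η (s - R - (t - t₀))) (deriv η (ρ - R - (t - t₀))) ρ := by
      exact (hA.comp ρ (((hasDerivAt_id ρ).sub_const R).sub_const (t - t₀))).congr_deriv (mul_one _)
    have hBr : HasDerivAt (fun s => η (M - (t - t₀) - s)) (-deriv η (M - (t - t₀) - ρ)) ρ := by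
      exact (hB.comp ρ ((hasDerivAt_id ρ).const_sub (M - (t - t₀)))).congr_deriv (mul_neg_one _)
    rw [(hasDerivAt_partialTime ((hχ_smooth.mul he).differentiable one_ne_zero) t ρ).unique
        ((hAt.mul hBt).mul (hasDerivAt_partialTime (he.differentiable one_ne_zero) t ρ)),
      (hasDerivAt_partialRadius ((hχ_smooth.mul hm).neg.differentiable one_ne_zero) t ρ).unique
        ((hAr.mul hBr).mul (hasDerivAt_partialRadius (hm.differentiable one_ne_zero) t ρ)).neg, hd]
    have h₁ := mul_nonneg (hη_deriv_nonneg (ρ - R - (t - t₀)))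
      (expNegInvGlue.nonneg (M - (t - t₀) - ρ))
    have h₂ := mul_nonneg (hη_deriv_nonneg (M - (t - t₀) - ρ))
      (expNegInvGlue.nonneg (ρ - R - (t - t₀)))
    obtain ⟨h₃, h₄⟩ := abs_le.1 (abs_momentum_le φ (t, ρ))
    have h₅ := mul_nonneg h₁ (neg_le_iff_add_nonneg.1 h₃)
    have h₆ := mul_nonneg h₂ (sub_nonneg.2 h₄)
    simp only [← hη] at h₅ h₆
    simp only [Pi.mul_apply]
    linear_combination h₅ + h₆
  have hout : ∫ t in t₀..t₁, -(χ (t, M) * momentum φ (t, M)) = 0 := by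
    refine intervalIntegral.integral_zero_ae (ae_of_all _ fun t htt => ?_)
    rw [uIoc_of_le ht] at htt
    have : η (M - (t - t₀) - M) = 0 := expNegInvGlue.zero_of_nonpos (by linarith [htt.1])
    simp only [hχ, this]
    simp
  have hin : ∫ t in t₀..t₁, -(χ (t, 0) * momentum φ (t, 0)) = 0 := by
    refine intervalIntegral.integral_zero_ae (ae_of_all _ fun t htt => ?_)
    rw [uIoc_of_le ht] at htt
    have : η (0 - R - (t - t₀)) = 0 := expNegInvGlue.zero_of_nonpos (by linarith [htt.1])
    simp only [hχ, this]
    simp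
  have hinit : ∫ r in (0 : ℝ)..M, χ (t₀, r) * reducedEnergy φ (t₀, r) = 0 := by
    refine intervalIntegral.integral_zero_ae (ae_of_all _ fun ρ _ => ?_)
    rcases le_or_gt ρ R with h | h
    · have : η (ρ - R - (t₀ - t₀)) = 0 := expNegInvGlue.zero_of_nonpos (by linarith)
      simp only [hχ, this]
      simp
    · rw [(densities_eq_zero (eventually_nhds_of_exterior h hdata)).2, mul_zero]
  have hpos : 0 < ∫ r in (0 : ℝ)..M, χ (t₁, r) * reducedEnergy φ (t₁, r) := by
    refine intervalIntegral.integral_pos (by linarith)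
      ((hχ_smooth.mul he).continuous.comp (by fun_prop)).continuousOn
      (fun ρ _ => mul_nonneg (hχ_nonneg _) (reducedEnergy_nonneg φ _))
      ⟨r, ⟨by linarith, by linarith⟩, mul_pos ?_ ?_⟩
    · exact mul_pos (expNegInvGlue.pos_of_pos (by simp only; linarith))
        (expNegInvGlue.pos_of_pos (by simp only; linarith))
    · have : 0 < potentialDensity φ (t₁, r) :=
        mul_pos (pow_pos (by simp only; linarith) 2) (Fpot_pos hne)
      unfold reducedEnergy
      positivity
  linarith

/-! ### The Morawetz inequality and the radial Sobolev inequality -/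

lemma IsRadialWave.morawetz {J : Set ℝ} {φ : ℝ × ℝ → ℝ} (hφ : IsRadialWave J φ)
    {a b R : ℝ} (hab : a ≤ b) (hR : 0 ≤ R) (hJ : Icc a b ⊆ J)
    (hsupp : ∀ t ∈ Icc a b, ∀ᶠ q in 𝓝 (t, R), φ q = 0) :
    ∫ t in a..b, ∫ r in (0 : ℝ)..R, r * (φ (t, r) * nonlin (φ (t, r)) - 2 * Fpot (φ (t, r))) ≤
      (∫ r in (0 : ℝ)..R, reducedEnergy φ (a, r)) + ∫ r in (0 : ℝ)..R, reducedEnergy φ (b, r) := by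
  have hc := hφ.contDiff
  have hm := contDiff_momentum hc
  have he := contDiff_reducedEnergy hc
  have hdiv := integral_divergence_rectangle hm
    ((contDiff_const (c := (2 : ℝ)).mul (contDiff_potentialDensity hc)).sub he) a b 0 R
  have hflux : ∫ t in a..b, ∫ r in (0 : ℝ)..R, (∂ₜ (momentum φ) (t, r) +
      ∂ᵣ (fun p => 2 * potentialDensity φ p - reducedEnergy φ p) (t, r)) =
      -∫ t in a..b, ∫ r in (0 : ℝ)..R,
        r * (φ (t, r) * nonlin (φ (t, r)) - 2 * Fpot (φ (t, r))) := by
    rw [← intervalIntegral.integral_neg]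
    refine intervalIntegral.integral_congr fun t ht => ?_
    rw [uIcc_of_le hab] at ht
    rw [← intervalIntegral.integral_neg]
    refine intervalIntegral.integral_congr fun r hr => ?_
    rw [uIcc_of_le hR] at hr
    exact hφ.morawetz_flux (hJ ht) hr.1
  have hout : ∫ t in a..b, (2 * potentialDensity φ (t, R) - reducedEnergy φ (t, R)) = 0 := by
    refine intervalIntegral.integral_zero_ae (ae_of_all _ fun t ht => ?_)
    rw [uIoc_of_le hab] at ht
    obtain ⟨h₁, h₂⟩ := densities_eq_zero (hsupp t (Ioc_subset_Icc_self ht))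
    rw [h₁, h₂]
    simp
  have hin : 0 ≤ -∫ t in a..b, (2 * potentialDensity φ (t, 0) - reducedEnergy φ (t, 0)) := by
    rw [← intervalIntegral.integral_neg]
    refine intervalIntegral.integral_nonneg hab fun t _ => ?_
    have : potentialDensity φ (t, 0) = 0 := by simp [potentialDensity]
    rw [this]
    linarith [reducedEnergy_nonneg φ (t, 0)]
  have hslice : ∀ (t : ℝ), Continuous fun r : ℝ => (t, r) := fun t => by fun_prop
  have hbound : ∀ t, |∫ r in (0 : ℝ)..R, momentum φ (t, r)| ≤
      ∫ r in (0 : ℝ)..R, reducedEnergy φ (t, r) := fun t =>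
    (intervalIntegral.abs_integral_le_integral_abs hR).trans
      (intervalIntegral.integral_mono_on hR
        ((hm.continuous.comp (hslice t)).abs.intervalIntegrable _ _)
        ((he.continuous.comp (hslice t)).intervalIntegrable _ _)
        fun r _ => abs_momentum_le φ (t, r))
  linarith [(abs_le.1 (hbound a)).2, (abs_le.1 (hbound b)).1]

/-- The energy density per unit radius of the wave `φ`. -/
def radialEnergy (φ : ℝ × ℝ → ℝ) (p : ℝ × ℝ) : ℝ :=
  (1 / 2) * ∂ₜ φ p ^ 2 + (1 / 2) * ∂ᵣ φ p ^ 2 + Fpot (φ p)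

lemma continuous_radialEnergy {φ : ℝ × ℝ → ℝ} (hφ : ContDiff ℝ ∞ φ) :
    Continuous (radialEnergy φ) :=
  ((continuous_const.mul ((contDiff_partialTime hφ).continuous.pow 2)).add
    (continuous_const.mul ((contDiff_partialRadius hφ).continuous.pow 2))).add
    (contDiff_Fpot.continuous.comp hφ.continuous)

lemma radialEnergy_nonneg (φ : ℝ × ℝ → ℝ) (p : ℝ × ℝ) : 0 ≤ radialEnergy φ p := by
  have := Fpot_nonneg (φ p)
  unfold radialEnergy
  positivity

lemma integral_reducedEnergy {φ : ℝ × ℝ → ℝ} (hφ : ContDiff ℝ ∞ φ) (t R : ℝ) :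
    ∫ r in (0 : ℝ)..R, reducedEnergy φ (t, r) =
      (∫ r in (0 : ℝ)..R, r ^ 2 * radialEnergy φ (t, r)) + (1 / 2) * (R * φ (t, R) ^ 2) := by
  have hd := hφ.differentiable (by simp)
  have hslice : Continuous fun r : ℝ => (t, r) := by fun_prop
  have hw : ∀ r : ℝ, HasDerivAt (fun s => (1 / 2) * (s * φ (t, s) ^ 2))
      (reducedEnergy φ (t, r) - r ^ 2 * radialEnergy φ (t, r)) r := fun r => by
    refine (((hasDerivAt_id r).mul ((hasDerivAt_partialRadius hd t r).pow 2)).const_mul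
      (1 / 2)).congr_deriv ?_
    simp only [reducedEnergy, radialEnergy, potentialDensity, partialTime_reduced hd,
      partialRadius_reduced hd, id]
    norm_num
    ring
  have h₁ : Continuous fun r => reducedEnergy φ (t, r) :=
    (contDiff_reducedEnergy hφ).continuous.comp hslice
  have h₂ : Continuous fun r => r ^ 2 * radialEnergy φ (t, r) :=
    (continuous_id.pow 2).mul ((continuous_radialEnergy hφ).comp hslice)
  have h := intervalIntegral.integral_eq_sub_of_hasDerivAt (a := 0) (b := R) (fun r _ => hw r)
    ((h₁.sub h₂).intervalIntegrable _ _)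
  rw [intervalIntegral.integral_sub (h₁.intervalIntegrable _ _) (h₂.intervalIntegrable _ _)] at h
  simp only [zero_mul, mul_zero, sub_zero] at h
  linarith

/-- The radial Sobolev inequality. -/
lemma mul_sq_le_integral_reducedEnergy {φ : ℝ × ℝ → ℝ} (hφ : ContDiff ℝ ∞ φ) {t r R : ℝ}
    (hr : 0 ≤ r) (hrR : r ≤ R) :
    r * φ (t, r) ^ 2 ≤ 2 * ∫ ρ in (0 : ℝ)..R, reducedEnergy φ (t, ρ) := by
  have h := integral_reducedEnergy hφ t r
  have hnonneg : 0 ≤ ∫ ρ in (0 : ℝ)..r, ρ ^ 2 * radialEnergy φ (t, ρ) :=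
    intervalIntegral.integral_nonneg hr fun ρ _ =>
      mul_nonneg (sq_nonneg _) (radialEnergy_nonneg φ _)
  have he : Continuous fun ρ => reducedEnergy φ (t, ρ) :=
    (contDiff_reducedEnergy hφ).continuous.comp (by fun_prop)
  have hmono := intervalIntegral.integral_mono_interval (μ := volume) le_rfl hr hrR
    (ae_of_all _ fun ρ => reducedEnergy_nonneg φ (t, ρ)) (he.intervalIntegrable 0 R)
  linarith

/-- The spacetime bound on a time interval, in radial coordinates. -/
lemma IsRadialWave.spacetime_bound {J : Set ℝ} {φ : ℝ × ℝ → ℝ} (hφ : IsRadialWave J φ)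
    {a b R H : ℝ} (hab : a ≤ b) (hR : 0 ≤ R) (hJ : Icc a b ⊆ J)
    (hsupp : ∀ t ∈ Icc a b, ∀ᶠ q in 𝓝 (t, R), φ q = 0)
    (hH : ∀ t ∈ Icc a b, ∫ r in (0 : ℝ)..R, r ^ 2 * radialEnergy φ (t, r) ≤ H) :
    ∫ t in a..b, ∫ r in (0 : ℝ)..R,
      r ^ 2 * (φ (t, r) ^ 8 * Real.log (2 + φ (t, r) ^ 2)) ≤ 6 * H ^ 2 := by
  have hc := hφ.contDiff
  have hE : ∀ t ∈ Icc a b, ∫ r in (0 : ℝ)..R, reducedEnergy φ (t, r) ≤ H := fun t ht => by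
    rw [integral_reducedEnergy hc, (hsupp t ht).self_of_nhds]
    simpa using hH t ht
  have hH0 : 0 ≤ H := (intervalIntegral.integral_nonneg hR fun r _ =>
    mul_nonneg (sq_nonneg _) (radialEnergy_nonneg φ _)).trans (hH a (left_mem_Icc.2 hab))
  set A : ℝ × ℝ → ℝ := fun p => p.2 ^ 2 * (φ p ^ 8 * Real.log (2 + φ p ^ 2)) with hA
  set B : ℝ × ℝ → ℝ := fun p => p.2 * (φ p * nonlin (φ p) - 2 * Fpot (φ p)) with hB
  have hφc := hc.continuous
  have hAc : Continuous A := by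
    refine (continuous_snd.pow 2).mul ((hφc.pow 8).mul
      (Continuous.log (continuous_const.add (hφc.pow 2)) fun p => ?_))
    positivity
  have hBc : Continuous B := continuous_snd.mul ((hφc.mul (continuous_nonlin.comp hφc)).sub
    (continuous_const.mul (contDiff_Fpot.continuous.comp hφc)))
  have hslice : ∀ t : ℝ, Continuous fun r : ℝ => (t, r) := fun t => by fun_prop
  have hint : ∀ {g : ℝ × ℝ → ℝ}, Continuous g →
      Continuous fun t => ∫ r in (0 : ℝ)..R, g (t, r) := fun {g} hg =>
    intervalIntegral.continuous_parametric_intervalIntegral_of_continuous'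
      (f := fun t r => g (t, r)) hg 0 R
  have hpoint : ∀ t ∈ Icc a b, ∀ r ∈ Icc 0 R, A (t, r) ≤ 3 * H * B (t, r) := fun t ht r hr => by
    have h₁ := mul_sq_le_integral_reducedEnergy hc (t := t) hr.1 hr.2
    have h₂ := six_mul_Fpot_le (φ (t, r))
    have h₃ : φ (t, r) * nonlin (φ (t, r)) = φ (t, r) ^ 6 * Real.log (2 + φ (t, r) ^ 2) := by
      unfold nonlin
      ring
    have h₄ : 0 ≤ r * (φ (t, r) ^ 6 * Real.log (2 + φ (t, r) ^ 2)) :=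
      mul_nonneg hr.1 (mul_nonneg (by positivity) (log_two_add_sq_pos _).le)
    have h₅ : r * φ (t, r) ^ 2 ≤ 2 * H := h₁.trans (by linarith [hE t ht])
    calc A (t, r) = r * φ (t, r) ^ 2 * (r * (φ (t, r) ^ 6 * Real.log (2 + φ (t, r) ^ 2))) := by
          simp only [hA]
          ring
      _ ≤ 2 * H * (r * (φ (t, r) ^ 6 * Real.log (2 + φ (t, r) ^ 2))) :=
          mul_le_mul_of_nonneg_right h₅ h₄
      _ ≤ 3 * H * B (t, r) := by
          rw [h₃] at h₂
          simp only [hB]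
          rw [h₃]
          nlinarith [mul_nonneg (mul_nonneg hH0 hr.1) (sub_nonneg.2 h₂)]
  have hmain : ∫ t in a..b, ∫ r in (0 : ℝ)..R, A (t, r) ≤
      ∫ t in a..b, 3 * H * ∫ r in (0 : ℝ)..R, B (t, r) := by
    refine intervalIntegral.integral_mono_on hab ((hint hAc).intervalIntegrable _ _)
      ((continuous_const.mul (hint hBc)).intervalIntegrable _ _) fun t ht => ?_
    rw [← intervalIntegral.integral_const_mul]
    exact intervalIntegral.integral_mono_on hR ((hAc.comp (hslice t)).intervalIntegrable _ _)
      ((continuous_const.mul (hBc.comp (hslice t))).intervalIntegrable _ _) (hpoint t ht)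
  have hmor := hφ.morawetz hab hR hJ hsupp
  rw [intervalIntegral.integral_const_mul] at hmain
  have hmul := mul_le_mul_of_nonneg_left (hmor.trans (add_le_add (hE a (left_mem_Icc.2 hab))
    (hE b (right_mem_Icc.2 hab)))) (by positivity : 0 ≤ 3 * H)
  linarith

/-! ### Radial functions on `ℝ³` -/

lemma norm_smul_single (r : ℝ) (i : Fin 3) :
    ‖(r • EuclideanSpace.single i 1 : Sp)‖ = |r| := by
  simp [norm_smul]

lemma hasDerivAt_comp_line {w : Sp → ℝ} (hw : Differentiable ℝ w) (x y : Sp) (s : ℝ) :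
    HasDerivAt (fun s : ℝ => w (x + s • y)) (fderiv ℝ w (x + s • y) y) s := by
  have h := (hw (x + s • y)).hasFDerivAt.comp_hasDerivAt s
    (((hasDerivAt_id s).smul_const y).const_add x)
  rw [one_smul] at h
  exact h

lemma contDiff_pd {w : Sp → ℝ} (hw : ContDiff ℝ ∞ w) (i : Fin 3) : ContDiff ℝ ∞ (pd i w) :=
  (hw.fderiv_right (by simp)).clm_apply contDiff_const

lemma hasDerivAt_axis {w : Sp → ℝ} (hw : Differentiable ℝ w) (r : ℝ) :
    HasDerivAt (fun s : ℝ => w (s • EuclideanSpace.single 0 1))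
      (pd 0 w (r • EuclideanSpace.single 0 1)) r := by
  simpa [pd] using hasDerivAt_comp_line hw 0 (EuclideanSpace.single 0 1) r

lemma norm_smul_single_add_smul_single {i : Fin 3} (hi : i ≠ 0) (r s : ℝ) :
    ‖(r • EuclideanSpace.single 0 1 + s • EuclideanSpace.single i 1 : Sp)‖ =
      √(r ^ 2 + s ^ 2) := by
  rw [EuclideanSpace.norm_eq]
  congr 1
  fin_cases i <;> simp [Fin.sum_univ_three] at hi ⊢

lemma pd_pd_of_ne_zero {w : Sp → ℝ} (hw : ContDiff ℝ ∞ w)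
    (hrad : ∀ x y : Sp, ‖x‖ = ‖y‖ → w x = w y) {i : Fin 3} (hi : i ≠ 0) {r : ℝ} (hr : 0 < r) :
    pd i (pd i w) (r • EuclideanSpace.single 0 1) =
      pd 0 w (r • EuclideanSpace.single 0 1) / r := by
  have hd := hw.differentiable (by simp)
  have hpos : ∀ s : ℝ, 0 < r ^ 2 + s ^ 2 := fun s => by positivity
  have hsqrt : ∀ s : ℝ, HasDerivAt (fun s : ℝ => √(r ^ 2 + s ^ 2)) (s / √(r ^ 2 + s ^ 2)) s :=
    fun s => by
      refine ((((hasDerivAt_id s).pow 2).const_add (r ^ 2)).sqrt (hpos s).ne').congr_deriv ?_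
      have := (sqrt_pos.2 (hpos s)).ne'
      simp only [id]
      norm_num
      field_simp
  have hfun : ∀ s : ℝ, w (r • EuclideanSpace.single 0 1 + s • EuclideanSpace.single i 1) =
      w (√(r ^ 2 + s ^ 2) • EuclideanSpace.single 0 1) := fun s => hrad _ _ <| by
    rw [norm_smul_single_add_smul_single hi, norm_smul_single, abs_of_nonneg (sqrt_nonneg _)]
  set k : ℝ → ℝ := fun s =>
    pd 0 w (√(r ^ 2 + s ^ 2) • EuclideanSpace.single 0 1) / √(r ^ 2 + s ^ 2) with hk
  have hpd : ∀ s : ℝ,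
      pd i w (r • EuclideanSpace.single 0 1 + s • EuclideanSpace.single i 1) = s * k s := fun s => by
    have h₁ := hasDerivAt_comp_line hd (r • EuclideanSpace.single 0 1)
      (EuclideanSpace.single i 1) s
    simp only [hfun] at h₁
    refine (h₁.unique ((hasDerivAt_axis hd _).comp s (hsqrt s))).trans ?_
    simp only [hk]
    ring
  have hkd : DifferentiableAt ℝ k 0 := by
    have h₁ := (hsqrt 0).differentiableAt
    have h₂ := (contDiff_pd hw 0).differentiable (by simp)
      (√(r ^ 2 + 0 ^ 2) • EuclideanSpace.single 0 1)
    exact (h₂.comp (0 : ℝ) (h₁.smul_const (EuclideanSpace.single 0 1))).div h₁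
      (sqrt_pos.2 (hpos 0)).ne'
  have h := hasDerivAt_comp_line ((contDiff_pd hw i).differentiable (by simp))
    (r • EuclideanSpace.single 0 1) (EuclideanSpace.single i 1) 0
  simp only [hpd] at h
  have h' := h.unique ((hasDerivAt_id (0 : ℝ)).mul hkd.hasDerivAt)
  simpa [hk, sqrt_sq hr.le, pd] using h'

lemma pd_zero_axis_zero {w : Sp → ℝ} (hw : ContDiff ℝ ∞ w)
    (hrad : ∀ x y : Sp, ‖x‖ = ‖y‖ → w x = w y) :
    pd 0 w ((0 : ℝ) • EuclideanSpace.single 0 1) = 0 := by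
  have h := hasDerivAt_axis (hw.differentiable (by simp)) 0
  have h' : HasDerivAt (fun s : ℝ => w (s • EuclideanSpace.single 0 1))
      (pd 0 w (-(0 : ℝ) • EuclideanSpace.single 0 1) * -1) 0 := by
    refine (((hasDerivAt_axis (hw.differentiable (by simp)) (-0)).comp (0 : ℝ)
      (hasDerivAt_neg 0))).congr_of_eventuallyEq (Eventually.of_forall fun s => hrad _ _ ?_)
    simp [norm_smul_single]
  have := h.unique h'
  rw [neg_zero] at this
  linarith

/-- The Laplacian of a radial function. -/
lemma mul_lap_of_radial {w : Sp → ℝ} (hw : ContDiff ℝ ∞ w)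
    (hrad : ∀ x y : Sp, ‖x‖ = ‖y‖ → w x = w y) {r : ℝ} (hr : 0 ≤ r) :
    r * lap w (r • EuclideanSpace.single 0 1) =
      r * pd 0 (pd 0 w) (r • EuclideanSpace.single 0 1) +
        2 * pd 0 w (r • EuclideanSpace.single 0 1) := by
  rcases hr.eq_or_lt with rfl | hr
  · rw [pd_zero_axis_zero hw hrad]
    simp
  · unfold lap
    rw [Fin.sum_univ_three, pd_pd_of_ne_zero hw hrad (i := 1) (by decide) hr,
      pd_pd_of_ne_zero hw hrad (i := 2) (by decide) hr]
    field_simp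
    ring

lemma sq_pd_zero_axis_le {w : Sp → ℝ} (hw : ContDiff ℝ ∞ w)
    (hrad : ∀ x y : Sp, ‖x‖ = ‖y‖ → w x = w y) {x : Sp} (hx : x ≠ 0) :
    pd 0 w (‖x‖ • EuclideanSpace.single 0 1) ^ 2 ≤ ∑ i, pd i w x ^ 2 := by
  have hd := hw.differentiable (by simp)
  have hx' : ‖x‖ ≠ 0 := norm_ne_zero_iff.2 hx
  set θ : Sp := ‖x‖⁻¹ • x with hθ
  have hθx : ‖x‖ • θ = x := smul_inv_smul₀ hx' x
  have hθn : ‖θ‖ = 1 := norm_smul_inv_norm hx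
  have h₁ := hasDerivAt_comp_line hd 0 θ ‖x‖
  simp only [zero_add, hθx] at h₁
  have h₂ : fderiv ℝ w x θ = pd 0 w (‖x‖ • EuclideanSpace.single 0 1) := by
    refine h₁.unique ((hasDerivAt_axis hd ‖x‖).congr_of_eventuallyEq
      (Eventually.of_forall fun s => hrad _ _ ?_))
    rw [norm_smul_single, norm_smul, hθn, mul_one, Real.norm_eq_abs]
  have h₃ : ∑ i, θ i * pd i w x = fderiv ℝ w x θ := by
    conv_rhs => rw [← (EuclideanSpace.basisFun (Fin 3) ℝ).sum_repr θ]
    simp [pd]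
  have h₄ : ∑ i, θ i ^ 2 = 1 := by
    rw [← EuclideanSpace.real_norm_sq_eq, hθn, one_pow]
  rw [← h₂, ← h₃]
  calc _ ≤ (∑ i, θ i ^ 2) * ∑ i, pd i w x ^ 2 := Finset.sum_mul_sq_le_sq_mul_sq _ _ _
    _ = _ := by rw [h₄, one_mul]

/-- The area of the unit sphere of `ℝ³`. -/
def sphereArea : ℝ := 3 * (volume : Measure Sp).real (Metric.ball 0 1)

lemma sphereArea_pos : 0 < sphereArea :=
  mul_pos three_pos (ENNReal.toReal_pos (Metric.measure_ball_pos _ _ one_pos).ne'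
    measure_ball_lt_top.ne)

/-- Integration in polar coordinates. -/
lemma integral_norm_eq {g : ℝ → ℝ} {R : ℝ} (hR : 0 ≤ R) (hg : ∀ r > R, g r = 0) :
    ∫ x : Sp, g ‖x‖ = sphereArea * ∫ r in (0 : ℝ)..R, r ^ 2 * g r := by
  rw [integral_fun_norm_addHaar volume g, finrank_euclideanSpace_fin, sphereArea,
    intervalIntegral.integral_of_le hR]
  have h : ∫ r in Ioc 0 R, r ^ 2 * g r = ∫ r in Ioi 0, r ^ 2 * g r :=
    (setIntegral_eq_of_subset_of_forall_sdiff_eq_zero measurableSet_Ioi Ioc_subset_Ioi_self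
      fun r hr => by
        rw [hg r (lt_of_not_ge fun h => hr.2 ⟨hr.1, h⟩), mul_zero]).symm
  rw [h]
  simp [mul_assoc]

/-! ### The radial profile of a solution -/

/-- The restriction of `u` to the half-line spanned by the first basis vector. -/
def radialProfile (u : ℝ → Sp → ℝ) (p : ℝ × ℝ) : ℝ :=
  u p.1 (p.2 • EuclideanSpace.single 0 1)

lemma contDiff_radialProfile {u : ℝ → Sp → ℝ}
    (hu : ContDiff ℝ ∞ fun p : ℝ × Sp => u p.1 p.2) : ContDiff ℝ ∞ (radialProfile u) :=
  hu.comp (contDiff_fst.prodMk (contDiff_snd.smul contDiff_const))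

lemma contDiff_slice {u : ℝ → Sp → ℝ}
    (hu : ContDiff ℝ ∞ fun p : ℝ × Sp => u p.1 p.2) (t : ℝ) : ContDiff ℝ ∞ (u t) :=
  hu.comp (contDiff_const.prodMk contDiff_id)

lemma partialRadius_radialProfile {u : ℝ → Sp → ℝ}
    (hu : ContDiff ℝ ∞ fun p : ℝ × Sp => u p.1 p.2) (t r : ℝ) :
    ∂ᵣ (radialProfile u) (t, r) = pd 0 (u t) (r • EuclideanSpace.single 0 1) :=
  (hasDerivAt_partialRadius ((contDiff_radialProfile hu).differentiable (by simp)) t r).unique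
    (hasDerivAt_axis ((contDiff_slice hu t).differentiable (by simp)) r)

lemma IsRadialSolution.eq_radialProfile {I : Set ℝ} {u : ℝ → Sp → ℝ}
    (hrad : IsRadialSolution I u) {t : ℝ} (ht : t ∈ I) (x : Sp) :
    u t x = radialProfile u (t, ‖x‖) :=
  hrad t ht _ _ (by rw [norm_smul_single, abs_norm])

lemma IsClassicalSolution.isRadialWave {I : Set ℝ} {u : ℝ → Sp → ℝ}
    (hu : IsClassicalSolution I u) (hrad : IsRadialSolution I u) :
    IsRadialWave I (radialProfile u) := by
  obtain ⟨hsmooth, -, heq⟩ := hu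
  have hc := contDiff_radialProfile hsmooth
  refine ⟨hc, fun t ht r hr => ?_⟩
  have h₁ : deriv (deriv fun s => u s (r • EuclideanSpace.single 0 1)) t =
      ∂ₜ (∂ₜ (radialProfile u)) (t, r) := by
    have : (deriv fun s => u s (r • EuclideanSpace.single 0 1)) =
        fun s => ∂ₜ (radialProfile u) (s, r) :=
      funext fun s => (hasDerivAt_partialTime (hc.differentiable (by simp)) s r).deriv
    rw [this]
    exact (hasDerivAt_partialTime
      ((contDiff_partialTime hc).differentiable (by simp)) t r).deriv
  have h₂ : ∂ᵣ (∂ᵣ (radialProfile u)) (t, r) =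
      pd 0 (pd 0 (u t)) (r • EuclideanSpace.single 0 1) := by
    have h := hasDerivAt_partialRadius
      ((contDiff_partialRadius hc).differentiable (by simp)) t r
    simp only [partialRadius_radialProfile hsmooth] at h
    exact h.unique
      (hasDerivAt_axis ((contDiff_pd (contDiff_slice hsmooth t) 0).differentiable (by simp)) r)
  rw [← h₁, heq t ht, mul_sub, mul_lap_of_radial (contDiff_slice hsmooth t) (hrad t ht) hr, h₂,
    partialRadius_radialProfile hsmooth, radialProfile]

lemma IsClassicalSolution.exists_exterior {I : Set ℝ} {u : ℝ → Sp → ℝ}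
    (hu : IsClassicalSolution I u) {t : ℝ} (ht : t ∈ I) :
    ∃ n : ℕ, ∀ r > (n : ℝ), radialProfile u (t, r) = 0 := by
  obtain ⟨R, hR⟩ := (hu.2.1 t ht).isCompact.isBounded.subset_closedBall 0
  obtain ⟨n, hn⟩ := exists_nat_gt R
  refine ⟨n, fun r hr => image_eq_zero_of_notMem_tsupport (f := u t) fun h => ?_⟩
  have := hR h
  rw [mem_closedBall_zero_iff, norm_smul_single] at this
  linarith [le_abs_self r]

/-- By Baire's theorem, the supports are uniformly bounded near some time. -/
lemma exists_uniform_exterior {φ : ℝ × ℝ → ℝ} (hφ : Continuous φ) {c d : ℝ} (hcd : c < d)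
    (h : ∀ t ∈ Ioo c d, ∃ n : ℕ, ∀ r > (n : ℝ), φ (t, r) = 0) :
    ∃ t ∈ Ioo c d, ∃ n : ℕ, ∀ᶠ s in 𝓝 t, ∀ r > (n : ℝ), φ (s, r) = 0 := by
  set A : ℕ → Set ℝ := fun n => {t | ∀ r > (n : ℝ), φ (t, r) = 0} ∪ (Ioo c d)ᶜ with hA
  have hclosed : ∀ n, IsClosed (A n) := fun n => by
    refine IsClosed.union ?_ isOpen_Ioo.isClosed_compl
    simp only [ofPred_forall]
    exact isClosed_iInter fun r => isClosed_iInter fun _ =>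
      isClosed_eq (hφ.comp (by fun_prop)) continuous_const
  have hcover : ⋃ n, A n = univ := by
    refine eq_univ_of_forall fun t => mem_iUnion.2 ?_
    by_cases ht : t ∈ Ioo c d
    · obtain ⟨n, hn⟩ := h t ht
      exact ⟨n, Or.inl hn⟩
    · exact ⟨0, Or.inr ht⟩
  obtain ⟨t, ht, htA⟩ := (dense_iUnion_interior_of_closed hclosed hcover).inter_open_nonempty
    (Ioo c d) isOpen_Ioo (nonempty_Ioo.2 hcd)
  obtain ⟨n, hn⟩ := mem_iUnion.1 htA
  refine ⟨t, ht, n, ?_⟩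
  filter_upwards [mem_interior_iff_mem_nhds.1 hn, isOpen_Ioo.mem_nhds ht] with s hs hs'
  exact hs.resolve_right (not_not_intro hs')

/-! ### The energy and the spacetime bound -/

lemma continuous_energyDensity {u : ℝ → Sp → ℝ}
    (hu : ContDiff ℝ ∞ fun p : ℝ × Sp => u p.1 p.2) (t : ℝ) :
    Continuous fun x => (1 / 2) * deriv (fun s => u s x) t ^ 2 +
      (1 / 2) * ∑ i, pd i (u t) x ^ 2 + Fpot (u t x) := by
  have hslice := contDiff_slice hu t
  have hderiv : ∀ x, deriv (fun s => u s x) t =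
      fderiv ℝ (fun p : ℝ × Sp => u p.1 p.2) (t, x) (1, 0) := fun x => by
    have h := (hu.differentiable (by simp) (t, x)).hasFDerivAt.comp_hasDerivAt t
      ((hasDerivAt_id t).prodMk (hasDerivAt_const t x))
    exact h.deriv
  have h₁ : Continuous fun x => deriv (fun s => u s x) t := by
    simp only [hderiv]
    exact ((hu.continuous_fderiv (by simp)).comp (by fun_prop)).clm_apply continuous_const
  have h₂ : ∀ i, Continuous (pd i (u t)) := fun i => (contDiff_pd hslice i).continuous
  have h₃ := contDiff_Fpot.continuous.comp hslice.continuous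
  exact ((continuous_const.mul (h₁.pow 2)).add (continuous_const.mul
    (continuous_finsetSum _ fun i _ => (h₂ i).pow 2))).add h₃

lemma integral_radialEnergy_le_energy {I : Set ℝ} {u : ℝ → Sp → ℝ}
    (hu : IsClassicalSolution I u) (hrad : IsRadialSolution I u) {t R : ℝ}
    (ht : I ∈ 𝓝 t) (hR : 0 ≤ R)
    (hsupp : ∀ᶠ s in 𝓝 t, ∀ r > R, radialProfile u (s, r) = 0) :
    sphereArea * ∫ r in (0 : ℝ)..R, r ^ 2 * radialEnergy (radialProfile u) (t, r) ≤
      energy u t := by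
  have hc := contDiff_radialProfile hu.1
  have hd := hc.differentiable (by simp)
  have htI := mem_of_mem_nhds ht
  have hzero : ∀ r > R, radialEnergy (radialProfile u) (t, r) = 0 := fun r hr => by
    have h := eventually_nhds_of_exterior hr hsupp
    have h' : radialProfile u =ᶠ[𝓝 (t, r)] fun _ => 0 := h
    simp [radialEnergy, h.self_of_nhds, Fpot_zero, partialTime, partialRadius, h'.fderiv_eq]
  have htime : ∀ x, deriv (fun s => u s x) t = ∂ₜ (radialProfile u) (t, ‖x‖) := fun x =>
    ((hasDerivAt_partialTime hd t ‖x‖).congr_of_eventuallyEq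
      (Eventually.mono ht fun s hs => hrad.eq_radialProfile hs x)).deriv
  rw [← integral_norm_eq hR hzero]
  refine integral_mono_of_nonneg (ae_of_all _ fun x => radialEnergy_nonneg _ _)
    ((continuous_energyDensity hu.1 t).integrable_of_hasCompactSupport
      (HasCompactSupport.intro (isCompact_closedBall 0 R) fun x hx => ?_)) ?_
  · rw [mem_closedBall_zero_iff, not_le] at hx
    have hux : u t =ᶠ[𝓝 x] fun _ => 0 := by
      filter_upwards [continuous_norm.continuousAt.eventually_const_lt hx] with y hy
      rw [hrad.eq_radialProfile htI, hsupp.self_of_nhds _ hy]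
    have htx : ∂ₜ (radialProfile u) (t, ‖x‖) = 0 := by
      have h' : radialProfile u =ᶠ[𝓝 (t, ‖x‖)] fun _ => 0 := eventually_nhds_of_exterior hx hsupp
      simp [partialTime, h'.fderiv_eq]
    rw [htime, htx, hux.eq_of_nhds, Fpot_zero]
    simp [pd, hux.fderiv_eq]
  · filter_upwards [measure_eq_zero_iff_ae_notMem.1 (measure_singleton (0 : Sp))] with x hx
    have h := sq_pd_zero_axis_le (contDiff_slice hu.1 t) (hrad t htI) (x := x) hx
    rw [htime, radialEnergy, partialRadius_radialProfile hu.1, ← hrad.eq_radialProfile htI]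
    linarith

lemma setIntegral_Icc_spacetime_le {I : Set ℝ} (hI : I.OrdConnected) {u : ℝ → Sp → ℝ} {E : ℝ}
    (hu : IsClassicalSolution I u) (hrad : IsRadialSolution I u)
    (hE : ∀ t ∈ I, energy u t = E) {a b : ℝ} (hab : a ≤ b)
    (ha : a ∈ interior I) (hb : b ∈ interior I) :
    ∫ t in Icc a b, ∫ x, |u t x| ^ 8 * Real.log (2 + u t x ^ 2) ≤ 6 / sphereArea * E ^ 2 := by
  have hS := sphereArea_pos
  have hc := contDiff_radialProfile hu.1
  obtain ⟨c, hca, hc_sub⟩ := (mem_nhdsLE_iff_exists_Icc_subset).1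
    (mem_nhdsWithin_of_mem_nhds (isOpen_interior.mem_nhds ha))
  obtain ⟨d, hbd, hd_sub⟩ := (mem_nhdsGE_iff_exists_Icc_subset).1
    (mem_nhdsWithin_of_mem_nhds (isOpen_interior.mem_nhds hb))
  have hcI : c ∈ I := interior_subset (hc_sub ⟨le_rfl, hca.le⟩)
  have hdI : d ∈ I := interior_subset (hd_sub ⟨hbd.le, le_rfl⟩)
  have hcd : Icc c d ⊆ I := hI.out hcI hdI
  obtain ⟨t₀, ht₀, n, hn⟩ := exists_uniform_exterior hc.continuous hca fun t ht =>
    hu.exists_exterior (hcd ⟨ht.1.le, ht.2.le.trans (hab.trans hbd.le)⟩)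
  have hwave := hu.isRadialWave hrad
  set R : ℝ := n + (d - t₀) with hR
  have ht₀d : t₀ < d := ht₀.2.trans_le (hab.trans hbd.le)
  have hR0 : 0 ≤ R := add_nonneg n.cast_nonneg (sub_nonneg.2 ht₀d.le)
  have hvanish : ∀ t ∈ Ioo t₀ d, ∀ r > R, radialProfile u (t, r) = 0 := fun t ht r hr =>
    hwave.eq_zero_of_exterior ht.1.le (fun s hs => hcd ⟨ht₀.1.le.trans hs.1, hs.2.trans ht.2.le⟩)
      n.cast_nonneg hn (by linarith [ht.2])
  have hmem : ∀ t ∈ Icc a b, t ∈ Ioo t₀ d := fun t ht =>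
    ⟨ht₀.2.trans_le ht.1, ht.2.trans_lt hbd⟩
  have hev : ∀ t ∈ Icc a b, ∀ᶠ s in 𝓝 t, ∀ r > R, radialProfile u (s, r) = 0 := fun t ht =>
    Eventually.mono (isOpen_Ioo.mem_nhds (hmem t ht)) hvanish
  have hnhds : ∀ t ∈ Icc a b, I ∈ 𝓝 t := fun t ht =>
    mem_of_superset (Ioo_mem_nhds (ht₀.1.trans (hmem t ht).1) (hmem t ht).2)
      (Ioo_subset_Icc_self.trans hcd)
  have hR1 : 0 ≤ R + 1 := by linarith
  have hbound := hwave.spacetime_bound (R := R + 1) (H := E / sphereArea) hab hR1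
    (fun t ht => mem_of_mem_nhds (hnhds t ht))
    (fun t ht => eventually_nhds_of_exterior (lt_add_one R) (hev t ht))
    fun t ht => by
      rw [le_div_iff₀' hS, ← hE t (mem_of_mem_nhds (hnhds t ht))]
      exact integral_radialEnergy_le_energy hu hrad (hnhds t ht) hR1
        ((hev t ht).mono fun s hs r hr => hs r (by linarith))
  have hpolar : ∀ t ∈ Icc a b, ∫ x, |u t x| ^ 8 * Real.log (2 + u t x ^ 2) =
      sphereArea * ∫ r in (0 : ℝ)..R + 1, r ^ 2 * (radialProfile u (t, r) ^ 8 *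
        Real.log (2 + radialProfile u (t, r) ^ 2)) := fun t ht => by
    rw [← integral_norm_eq hR1 (g := fun r => radialProfile u (t, r) ^ 8 *
      Real.log (2 + radialProfile u (t, r) ^ 2)) fun r hr => by
        simp [hvanish t (hmem t ht) r (by linarith)]]
    refine integral_congr_ae (ae_of_all _ fun x => ?_)
    simp only [← hrad.eq_radialProfile (mem_of_mem_nhds (hnhds t ht)),
      (by decide : Even 8).pow_abs]
  rw [setIntegral_congr_fun measurableSet_Icc hpolar, integral_Icc_eq_integral_Ioc,
    ← intervalIntegral.integral_of_le hab, intervalIntegral.integral_const_mul]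
  refine (mul_le_mul_of_nonneg_left hbound hS.le).trans_eq ?_
  field_simp

/-- **A priori spacetime bound.** For a spherically symmetric classical solution with
conserved energy `E`, `∫_I ∫_{ℝ³} |u|⁸ log(2+|u|²) dx dt ≤ C E²` for an absolute
constant `C`. -/
theorem spacetime_bound :
    ∃ C > (0:ℝ), ∀ (I : Set ℝ), I.OrdConnected → ∀ (u : ℝ → Sp → ℝ) (E : ℝ),
      IsClassicalSolution I u → IsRadialSolution I u →
      (∀ t ∈ I, energy u t = E) →
      (∫ t in I, ∫ x, |u t x| ^ 8 * Real.log (2 + (u t x) ^ 2)) ≤ C * E ^ 2 := by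
  have hS := sphereArea_pos
  refine ⟨6 / sphereArea, by positivity, fun I hI u E hu hrad hE => ?_⟩
  set G : ℝ → ℝ := fun t => ∫ x, |u t x| ^ 8 * Real.log (2 + u t x ^ 2) with hG
  have hG_nonneg : ∀ t, 0 ≤ G t := fun t =>
    integral_nonneg fun x => mul_nonneg (by positivity) (log_two_add_sq_pos _).le
  have hbound_nonneg : 0 ≤ 6 / sphereArea * E ^ 2 := by positivity
  by_cases hint : IntegrableOn G I
  swap
  · rwa [integral_undef hint]
  obtain ⟨A, hA_closed, hA_sub, hA_union, hA_mono⟩ :=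
    (isOpen_interior (s := I)).exists_iUnion_isClosed
  set K : ℕ → Set ℝ := fun n => A n ∩ Icc (-n : ℝ) n with hK
  have hK_mono : Monotone K := fun m n hmn => inter_subset_inter (hA_mono hmn)
    (Icc_subset_Icc (neg_le_neg (Nat.cast_le.2 hmn)) (Nat.cast_le.2 hmn))
  have hK_compact : ∀ n, IsCompact (K n) := fun n => isCompact_Icc.inter_left (hA_closed n)
  have hK_union : ⋃ n, K n = interior I := by
    refine Subset.antisymm (iUnion_subset fun n => inter_subset_left.trans (hA_sub n))
      fun t ht => ?_
    rw [← hA_union] at ht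
    obtain ⟨m, hm⟩ := mem_iUnion.1 ht
    obtain ⟨n, hn⟩ := exists_nat_ge |t|
    refine mem_iUnion.2 ⟨max m n, hA_mono (le_max_left m n) hm, abs_le.1 (hn.trans ?_)⟩
    exact_mod_cast le_max_right m n
  have hK_le : ∀ n, ∫ t in K n, G t ≤ 6 / sphereArea * E ^ 2 := fun n => by
    rcases (K n).eq_empty_or_nonempty with h | h
    · simpa [h] using hbound_nonneg
    have hsub : K n ⊆ interior I := hK_union ▸ subset_iUnion K n
    have ha := (hK_compact n).sInf_mem h
    have hb := (hK_compact n).sSup_mem h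
    have hab : sInf (K n) ≤ sSup (K n) :=
      csInf_le_csSup h (hK_compact n).bddBelow (hK_compact n).bddAbove
    refine (setIntegral_mono_set (hint.mono_set
      (hI.out (interior_subset (hsub ha)) (interior_subset (hsub hb))))
      (ae_of_all _ hG_nonneg) (Eventually.of_forall fun t ht =>
        ⟨csInf_le (hK_compact n).bddBelow ht, le_csSup (hK_compact n).bddAbove ht⟩)).trans ?_
    exact setIntegral_Icc_spacetime_le hI hu hrad hE hab (hsub ha) (hsub hb)
  have hlim := tendsto_setIntegral_of_monotone (fun n => (hK_compact n).measurableSet) hK_mono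
    (hK_union ▸ hint.mono_set interior_subset)
  rw [hK_union] at hlim
  rw [← setIntegral_congr_set (interior_ae_eq_of_null_frontier (hI.convex.addHaar_frontier volume))]
  exact le_of_tendsto' hlim hK_le
end
end
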